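/- Let Ω ⊂ ℝⁿ be a bounded strictly convex open domain with smooth boundary and diameter D = diam(Ω), and let V : Ω̄ → ℝ be a smooth convex potential. Then the ground state φ₀ of L = −Δ + V with Dirichlet boundary condition is log-concave on Ω, i.e. log φ₀ is a concave function on Ω. -/

import Mathlib

open Metric Set
open scoped RealInnerProductSpace

/-- The Laplacian of a function on Euclidean space, `Δ f x = ∑ i ∂²f/∂xᵢ²`. -/
noncomputable def lap {n : ℕ} (f : EuclideanSpace ℝ (Fin n) → ℝ)
    (x : EuclideanSpace ℝ (Fin n)) : ℝ :=
  ∑ i : Fin n, fderiv ℝ (fun y => fderiv ℝ f y (EuclideanSpace.single i 1)) x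
    (EuclideanSpace.single i 1)

open Filter Topology

theorem ball_infDist_frontier_subset {E : Type*} [NormedAddCommGroup E] [NormedSpace ℝ E]
    {Ω : Set E} (hΩ : IsOpen Ω) {x : E} (hx : x ∈ Ω) :
    ball x (infDist x (frontier Ω)) ⊆ Ω := by
  rcases le_or_gt (infDist x (frontier Ω)) 0 with h | h
  · simp [ball_eq_empty.2 h]
  have hpre : IsPreconnected (ball x (infDist x (frontier Ω))) :=
    (convex_ball _ _).isPreconnected
  refine hpre.subset_left_of_subset_union hΩ isClosed_closure.isOpen_compl
    (disjoint_compl_right.mono_left subset_closure) ?_ ⟨x, mem_ball_self h, hx⟩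
  intro y hy
  by_cases hyΩ : y ∈ Ω
  · exact Or.inl hyΩ
  · refine Or.inr fun hyc => ?_
    have : y ∈ frontier Ω := by
      rw [hΩ.frontier_eq]; exact ⟨hyc, hyΩ⟩
    exact disjoint_left.1 disjoint_ball_infDist hy this

theorem infDist_frontier_combo_le {E : Type*} [NormedAddCommGroup E] [NormedSpace ℝ E]
    {Ω : Set E} (hΩ : IsOpen Ω) (hconv : Convex ℝ Ω) (hfr : (frontier Ω).Nonempty)
    {x y : E} (hx : x ∈ Ω) (hy : y ∈ Ω) {a b : ℝ} (ha : 0 < a) (hb : 0 < b) (hab : a + b = 1) :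
    a * infDist x (frontier Ω) + b * infDist y (frontier Ω)
      ≤ infDist (a • x + b • y) (frontier Ω) := by
  refine (le_infDist hfr).2 fun q hq => ?_
  by_contra! hlt
  set dx := infDist x (frontier Ω)
  set dy := infDist y (frontier Ω)
  set s := a * dx + b * dy with hs
  have hdx : 0 < dx := by
    refine (isClosed_frontier.notMem_iff_infDist_pos hfr).1 fun h => ?_
    rw [hΩ.frontier_eq] at h; exact h.2 hx
  have hdy : 0 < dy := by
    refine (isClosed_frontier.notMem_iff_infDist_pos hfr).1 fun h => ?_
    rw [hΩ.frontier_eq] at h; exact h.2 hy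
  have hspos : 0 < s := by positivity
  set v := q - (a • x + b • y) with hv
  have hvn : ‖v‖ < s := by rwa [hv, ← dist_eq_norm, dist_comm]
  have key : ∀ (p : E) (d : ℝ), 0 < d → ball p d ⊆ Ω → p + (d / s) • v ∈ Ω := by
    intro p d hd hsub
    apply hsub
    rw [mem_ball, dist_eq_norm, add_sub_cancel_left, norm_smul, Real.norm_of_nonneg (by positivity),
      div_mul_eq_mul_div, div_lt_iff₀ hspos]
    exact mul_lt_mul_of_pos_left hvn hd
  have h := hconv (key x dx hdx (ball_infDist_frontier_subset hΩ hx))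
    (key y dy hdy (ball_infDist_frontier_subset hΩ hy)) ha.le hb.le hab
  have hq' : a • (x + (dx / s) • v) + b • (y + (dy / s) • v) = q := by
    have h1 : a * (dx / s) + b * (dy / s) = 1 := by
      rw [mul_div_assoc', mul_div_assoc', ← add_div, ← hs, div_self hspos.ne']
    have : a • (x + (dx / s) • v) + b • (y + (dy / s) • v)
        = (a • x + b • y) + (a * (dx / s) + b * (dy / s)) • v := by module
    rw [this, h1, one_smul, hv]; abel
  rw [hq'] at h
  rw [hΩ.frontier_eq] at hq
  exact hq.2 h

theorem second_deriv_nonpos_of_isLocalMax {g g' : ℝ → ℝ} {c : ℝ}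
    (hg : ∀ᶠ t in 𝓝 0, HasDerivAt g (g' t) t) (hg' : HasDerivAt g' c 0)
    (hmax : IsLocalMax g 0) : c ≤ 0 := by
  by_contra! hc
  have hd : deriv g =ᶠ[𝓝 0] g' := hg.mono fun t ht => ht.deriv
  have hdd : deriv (deriv g) 0 = c := by rw [hd.deriv_eq, hg'.deriv]
  have hmin : IsLocalMin g 0 := isLocalMin_of_deriv_deriv_pos (by rw [hdd]; exact hc)
    hmax.deriv_eq_zero hg.self_of_nhds.continuousAt
  have hconst : g =ᶠ[𝓝 0] fun _ => g 0 := by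
    filter_upwards [hmax, hmin] with t h1 h2 using le_antisymm h1 h2
  have h0 : deriv g =ᶠ[𝓝 0] fun _ => 0 := by
    have := hconst.deriv
    simpa using this
  have : deriv (deriv g) 0 = 0 := by rw [h0.deriv_eq]; simp
  linarith

theorem eventually_hasDerivAt_line {E : Type*} [NormedAddCommGroup E] [NormedSpace ℝ E]
    {f : E → ℝ} {U : Set E} (hU : IsOpen U) (hf : ContDiffOn ℝ 2 f U) {x : E} (hx : x ∈ U)
    (e : E) :
    ∀ᶠ t in 𝓝 (0 : ℝ), x + t • e ∈ U ∧
      HasDerivAt (fun t : ℝ => f (x + t • e)) (fderiv ℝ f (x + t • e) e) t := by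
  have hc : Tendsto (fun t : ℝ => x + t • e) (𝓝 0) (𝓝 x) := by
    have : Continuous fun t : ℝ => x + t • e := by fun_prop
    simpa using this.tendsto 0
  filter_upwards [hc (hU.mem_nhds hx)] with t ht
  refine ⟨ht, ?_⟩
  have hd : HasFDerivAt f (fderiv ℝ f (x + t • e)) (x + t • e) :=
    (((hf _ ht).contDiffAt (hU.mem_nhds ht)).differentiableAt (by norm_num)).hasFDerivAt
  have hl : HasDerivAt (fun t : ℝ => x + t • e) e t := by
    simpa using ((hasDerivAt_id t).smul_const e).const_add x
  exact hd.comp_hasDerivAt t hl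

theorem hasDerivAt_fderiv_line {E : Type*} [NormedAddCommGroup E] [NormedSpace ℝ E]
    {f : E → ℝ} {U : Set E} (hU : IsOpen U) (hf : ContDiffOn ℝ 2 f U) {x : E} (hx : x ∈ U)
    (e : E) :
    HasDerivAt (fun t : ℝ => fderiv ℝ f (x + t • e) e)
      (fderiv ℝ (fun y => fderiv ℝ f y e) x e) 0 := by
  have h1 : ContDiffAt ℝ 1 (fderiv ℝ f) x :=
    ((hf x hx).contDiffAt (hU.mem_nhds hx)).fderiv_right (by norm_num)
  have h2 : DifferentiableAt ℝ (fun y => fderiv ℝ f y e) x :=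
    (h1.differentiableAt (by norm_num)).clm_apply (differentiableAt_const e)
  have hl : HasDerivAt (fun t : ℝ => x + t • e) e 0 := by
    simpa using ((hasDerivAt_id (0 : ℝ)).smul_const e).const_add x
  have h3 : HasFDerivAt (fun y => fderiv ℝ f y e) (fderiv ℝ (fun y => fderiv ℝ f y e) x)
      (x + (0 : ℝ) • e) := by simpa using h2.hasFDerivAt
  exact h3.comp_hasDerivAt (0 : ℝ) hl

theorem eventually_hasDerivAt_log_line {E : Type*} [NormedAddCommGroup E] [NormedSpace ℝ E]
    {f : E → ℝ} {U : Set E} (hU : IsOpen U) (hf : ContDiffOn ℝ 2 f U) (hpos : ∀ x ∈ U, 0 < f x)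
    {x : E} (hx : x ∈ U) (e : E) :
    ∀ᶠ t in 𝓝 (0 : ℝ), HasDerivAt (fun t : ℝ => Real.log (f (x + t • e)))
      (fderiv ℝ f (x + t • e) e / f (x + t • e)) t := by
  filter_upwards [eventually_hasDerivAt_line hU hf hx e] with t ht
  exact ht.2.log (hpos _ ht.1).ne'

theorem hasDerivAt_logDeriv_line {E : Type*} [NormedAddCommGroup E] [NormedSpace ℝ E]
    {f : E → ℝ} {U : Set E} (hU : IsOpen U) (hf : ContDiffOn ℝ 2 f U) (hpos : ∀ x ∈ U, 0 < f x)
    {x : E} (hx : x ∈ U) (e : E) :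
    HasDerivAt (fun t : ℝ => fderiv ℝ f (x + t • e) e / f (x + t • e))
      (fderiv ℝ (fun y => fderiv ℝ f y e) x e / f x - (fderiv ℝ f x e / f x) ^ 2) 0 := by
  have h1 := hasDerivAt_fderiv_line hU hf hx e
  have h2 := (eventually_hasDerivAt_line hU hf hx e).self_of_nhds.2
  have hne : f (x + (0 : ℝ) • e) ≠ 0 := by simpa using (hpos x hx).ne'
  have h3 := h1.div h2 hne
  simp only [zero_smul, add_zero] at h3
  refine h3.congr_deriv ?_
  have := (hpos x hx).ne'
  field_simp

/-- The first and second order conditions at a local maximum of a perturbed two-point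
concavity function of `log φ`. -/
theorem two_point_max_ineq {n : ℕ} {Ω : Set (EuclideanSpace ℝ (Fin n))} (hΩ : IsOpen Ω)
    {V φ : EuclideanSpace ℝ (Fin n) → ℝ} {lam : ℝ} (hφ : ContDiffOn ℝ 2 φ Ω)
    (hpos : ∀ x ∈ Ω, 0 < φ x) (heig : ∀ x ∈ Ω, -lap φ x + V x * φ x = lam * φ x)
    {x y z w : EuclideanSpace ℝ (Fin n)} (hx : x ∈ Ω) (hy : y ∈ Ω) (hz : z ∈ Ω)
    {a b : ℝ} (ha : 0 < a) (hb : 0 < b) (hab : a + b = 1) (hzdef : z = a • x + b • y)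
    (hwdef : w = x - y) (hV : V z ≤ a * V x + b * V y) {δ ε A ψ : ℝ} (hδ : 0 ≤ δ) (hδ1 : δ ≤ 1)
    (hψ : ψ = Real.exp (A * ⟪w, z⟫))
    (hmax : IsLocalMax (fun p : EuclideanSpace ℝ (Fin n) × EuclideanSpace ℝ (Fin n) =>
      a * Real.log (φ p.1) + b * Real.log (φ p.2) - (1 - δ) * Real.log (φ (a • p.1 + b • p.2))
        + ε * Real.exp (A * ⟪p.1 - p.2, a • p.1 + b • p.2⟫)) (x, y)) :
    ε * A ^ 2 * ψ * ‖w‖ ^ 2 + 2 * ε * (1 - δ) * A * ψ * (fderiv ℝ φ z w / φ z)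
      + δ * (V z - lam)
      ≤ ε ^ 2 * (a * ‖(A * ψ) • (a⁻¹ • z + w)‖ ^ 2 + b * ‖(A * ψ) • (w - b⁻¹ • z)‖ ^ 2) := by
  set e : Fin n → EuclideanSpace ℝ (Fin n) := fun i => EuclideanSpace.single i 1 with he
  set p : EuclideanSpace ℝ (Fin n) → Fin n → ℝ := fun u i => fderiv ℝ φ u (e i) / φ u with hp
  set s : EuclideanSpace ℝ (Fin n) → Fin n → ℝ :=
    fun u i => fderiv ℝ (fun y => fderiv ℝ φ y (e i)) u (e i) / φ u - (p u i) ^ 2 with hs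
  have inner_e : ∀ u i, ⟪u, e i⟫ = u i := fun u i => by
    simp [he, EuclideanSpace.inner_single_right]
  have inner_e' : ∀ u i, ⟪e i, u⟫ = u i := fun u i => by
    simp [he, EuclideanSpace.inner_single_left]
  have hsum : ∀ u ∈ Ω, ∑ i, s u i = V u - lam - ∑ i, (p u i) ^ 2 := by
    intro u hu
    simp only [hs, Finset.sum_sub_distrib, ← Finset.sum_div]
    congr 1
    have h := heig u hu
    have hu0 := (hpos u hu).ne'
    rw [div_eq_iff hu0]
    change lap φ u = _
    linarith
  have hgw : fderiv ℝ φ z w / φ z = ∑ i, p z i * w i := by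
    have : w = ∑ i, w i • e i := by
      simpa [EuclideanSpace.basisFun_repr] using
        ((EuclideanSpace.basisFun (Fin n) ℝ).sum_repr w).symm
    conv_lhs => rw [this, map_sum, Finset.sum_div]
    refine Finset.sum_congr rfl fun i _ => ?_
    simp only [map_smul, smul_eq_mul, hp]; ring
  have hpx : ∀ i, p x i = (1 - δ) * p z i - ε * (A * ψ * (a⁻¹ * z i + w i)) := by
    intro i
    have hc : Tendsto (fun t : ℝ => (x + t • e i, y)) (𝓝 0) (𝓝 (x, y)) := by
      have : Continuous fun t : ℝ => (x + t • e i, y) := by fun_prop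
      simpa using this.tendsto 0
    have h0 : IsLocalMax (fun t : ℝ => a * Real.log (φ (x + t • e i)) + b * Real.log (φ y)
        - (1 - δ) * Real.log (φ (z + t • (a • e i)))
        + ε * Real.exp (A * (⟪w, z⟫ + (z i + a * w i) * t + a * t ^ 2))) 0 := by
      have h1 : ∀ t : ℝ, a • (x + t • e i) + b • y = z + t • (a • e i) := by
        intro t; rw [hzdef]; module
      have h2 : ∀ t : ℝ, ⟪x + t • e i - y, z + t • (a • e i)⟫
          = ⟪w, z⟫ + (z i + a * w i) * t + a * t ^ 2 := by
        intro t
        have : x + t • e i - y = w + t • e i := by rw [hwdef]; abel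
        rw [this]
        simp only [inner_add_left, inner_add_right, real_inner_smul_left, real_inner_smul_right,
          inner_e, inner_e']
        simp [he]; ring
      have := hc.eventually hmax
      simp only [h1, h2] at this
      have h3 := h2 0
      simp only [zero_smul, add_zero] at h3
      filter_upwards [this] with t ht
      simpa [← hzdef, ← hwdef] using ht
    have d1 := (eventually_hasDerivAt_log_line hΩ hφ hpos hx (e i)).self_of_nhds
    have d2 := (eventually_hasDerivAt_log_line hΩ hφ hpos hz (a • e i)).self_of_nhds
    have d3 : HasDerivAt (fun t : ℝ => A * (⟪w, z⟫ + (z i + a * w i) * t + a * t ^ 2))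
        (A * (z i + a * w i)) 0 := by
      have := ((((hasDerivAt_id (0 : ℝ)).const_mul (z i + a * w i)).const_add ⟪w, z⟫).add
        (((hasDerivAt_id (0 : ℝ)).pow 2).const_mul a)).const_mul A
      simpa using this
    have d := (((d1.const_mul a).add_const (b * Real.log (φ y))).sub (d2.const_mul (1 - δ))).add
      (d3.exp.const_mul ε)
    have h := h0.hasDerivAt_eq_zero d
    simp only [zero_smul, add_zero, map_smul, smul_eq_mul, mul_zero, ne_eq, OfNat.ofNat_ne_zero,
      not_false_eq_true, zero_pow, ← hψ] at h
    have h' : a * p x i - (1 - δ) * (a * p z i) + ε * (ψ * (A * (z i + a * w i))) = 0 := by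
      rw [← h]; simp only [hp]; ring
    field_simp
    linarith
  have hpy : ∀ i, p y i = (1 - δ) * p z i - ε * (A * ψ * (w i - b⁻¹ * z i)) := by
    intro i
    have hc : Tendsto (fun t : ℝ => (x, y + t • e i)) (𝓝 0) (𝓝 (x, y)) := by
      have : Continuous fun t : ℝ => (x, y + t • e i) := by fun_prop
      simpa using this.tendsto 0
    have h0 : IsLocalMax (fun t : ℝ => a * Real.log (φ x) + b * Real.log (φ (y + t • e i))
        - (1 - δ) * Real.log (φ (z + t • (b • e i)))
        + ε * Real.exp (A * (⟪w, z⟫ + (b * w i - z i) * t + -b * t ^ 2))) 0 := by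
      have h1 : ∀ t : ℝ, a • x + b • (y + t • e i) = z + t • (b • e i) := by
        intro t; rw [hzdef]; module
      have h2 : ∀ t : ℝ, ⟪x - (y + t • e i), z + t • (b • e i)⟫
          = ⟪w, z⟫ + (b * w i - z i) * t + -b * t ^ 2 := by
        intro t
        have : x - (y + t • e i) = w - t • e i := by rw [hwdef]; abel
        rw [this]
        simp only [inner_sub_left, inner_add_right, real_inner_smul_left, real_inner_smul_right,
          inner_e, inner_e']
        simp [he]; ring
      have := hc.eventually hmax
      simp only [h1, h2] at this
      filter_upwards [this] with t ht
      simpa [← hzdef, ← hwdef] using ht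
    have d1 := (eventually_hasDerivAt_log_line hΩ hφ hpos hy (e i)).self_of_nhds
    have d2 := (eventually_hasDerivAt_log_line hΩ hφ hpos hz (b • e i)).self_of_nhds
    have d3 : HasDerivAt (fun t : ℝ => A * (⟪w, z⟫ + (b * w i - z i) * t + -b * t ^ 2))
        (A * (b * w i - z i)) 0 := by
      have := ((((hasDerivAt_id (0 : ℝ)).const_mul (b * w i - z i)).const_add ⟪w, z⟫).add
        (((hasDerivAt_id (0 : ℝ)).pow 2).const_mul (-b))).const_mul A
      simpa using this
    have d := (((d1.const_mul b).const_add (a * Real.log (φ x))).sub (d2.const_mul (1 - δ))).add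
      (d3.exp.const_mul ε)
    have h := h0.hasDerivAt_eq_zero d
    simp only [zero_smul, add_zero, map_smul, smul_eq_mul, mul_zero, ne_eq, OfNat.ofNat_ne_zero,
      not_false_eq_true, zero_pow, ← hψ] at h
    have h' : b * p y i - (1 - δ) * (b * p z i) + ε * (ψ * (A * (b * w i - z i))) = 0 := by
      rw [← h]; simp only [hp]; ring
    field_simp
    linarith
  have hsec : ∀ i, a * s x i + b * s y i - (1 - δ) * s z i + ε * (ψ * (A * w i) * (A * w i))
      ≤ 0 := by
    intro i
    have hc : Tendsto (fun t : ℝ => (x + t • e i, y + t • e i)) (𝓝 0) (𝓝 (x, y)) := by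
      have : Continuous fun t : ℝ => (x + t • e i, y + t • e i) := by fun_prop
      simpa using this.tendsto 0
    have h0 : IsLocalMax (fun t : ℝ => a * Real.log (φ (x + t • e i))
        + b * Real.log (φ (y + t • e i)) - (1 - δ) * Real.log (φ (z + t • e i))
        + ε * Real.exp (A * (⟪w, z⟫ + w i * t))) 0 := by
      have h1 : ∀ t : ℝ, a • (x + t • e i) + b • (y + t • e i) = z + t • e i := by
        intro t
        have : a • (x + t • e i) + b • (y + t • e i) = a • x + b • y + (a + b) • (t • e i) := by
          module
        rw [this, hab, one_smul, hzdef]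
      have h2 : ∀ t : ℝ, ⟪x + t • e i - (y + t • e i), z + t • e i⟫ = ⟪w, z⟫ + w i * t := by
        intro t
        have : x + t • e i - (y + t • e i) = w := by rw [hwdef]; abel
        rw [this, inner_add_right, real_inner_smul_right, inner_e]; ring
      have := hc.eventually hmax
      simp only [h1, h2] at this
      filter_upwards [this] with t ht
      simpa [← hzdef, ← hwdef] using ht
    have d3 : ∀ t : ℝ, HasDerivAt (fun t : ℝ => Real.exp (A * (⟪w, z⟫ + w i * t)))
        (Real.exp (A * (⟪w, z⟫ + w i * t)) * (A * w i)) t := by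
      intro t
      have := (((hasDerivAt_id t).const_mul (w i)).const_add ⟪w, z⟫).const_mul A
      simpa using this.exp
    refine second_deriv_nonpos_of_isLocalMax
      (g' := fun t => a * (fderiv ℝ φ (x + t • e i) (e i) / φ (x + t • e i))
        + b * (fderiv ℝ φ (y + t • e i) (e i) / φ (y + t • e i))
        - (1 - δ) * (fderiv ℝ φ (z + t • e i) (e i) / φ (z + t • e i))
        + ε * (Real.exp (A * (⟪w, z⟫ + w i * t)) * (A * w i))) ?_ ?_ h0
    · filter_upwards [eventually_hasDerivAt_log_line hΩ hφ hpos hx (e i),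
        eventually_hasDerivAt_log_line hΩ hφ hpos hy (e i),
        eventually_hasDerivAt_log_line hΩ hφ hpos hz (e i)] with t h1 h2 h3
      exact (((h1.const_mul a).add (h2.const_mul b)).sub (h3.const_mul (1 - δ))).add
        ((d3 t).const_mul ε)
    · have h4 := (d3 0).mul_const (A * w i)
      simp only [mul_zero, add_zero, ← hψ] at h4
      exact ((((hasDerivAt_logDeriv_line hΩ hφ hpos hx (e i)).const_mul a).add
        ((hasDerivAt_logDeriv_line hΩ hφ hpos hy (e i)).const_mul b)).sub
        ((hasDerivAt_logDeriv_line hΩ hφ hpos hz (e i)).const_mul (1 - δ))).add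
        (h4.const_mul ε)
  have hS := Finset.sum_nonpos fun i (_ : i ∈ Finset.univ) => hsec i
  simp only [Finset.sum_add_distrib, Finset.sum_sub_distrib, ← Finset.mul_sum] at hS
  rw [hsum x hx, hsum y hy, hsum z hz] at hS
  have hnw : ∑ i, ψ * (A * w i) * (A * w i) = A ^ 2 * ψ * ‖w‖ ^ 2 := by
    rw [EuclideanSpace.norm_sq_eq, Finset.mul_sum]
    refine Finset.sum_congr rfl fun i _ => ?_
    rw [Real.norm_eq_abs, sq_abs]; ring
  rw [hnw] at hS
  have hquad : a * ∑ i, p x i ^ 2 + b * ∑ i, p y i ^ 2 - (1 - δ) * ∑ i, p z i ^ 2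
      = - (δ * (1 - δ) * ∑ i, p z i ^ 2) - 2 * ε * (1 - δ) * A * ψ * ∑ i, p z i * w i
        + ε ^ 2 * (a * ‖(A * ψ) • (a⁻¹ • z + w)‖ ^ 2 + b * ‖(A * ψ) • (w - b⁻¹ • z)‖ ^ 2) := by
    rw [EuclideanSpace.norm_sq_eq, EuclideanSpace.norm_sq_eq]
    simp only [Finset.mul_sum, ← Finset.sum_add_distrib, ← Finset.sum_sub_distrib,
      ← Finset.sum_neg_distrib]
    refine Finset.sum_congr rfl fun i _ => ?_
    rw [hpx i, hpy i]
    simp only [Real.norm_eq_abs, sq_abs, PiLp.smul_apply, PiLp.add_apply, PiLp.sub_apply,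
      smul_eq_mul]
    have hb' : b = 1 - a := by linarith
    have haa : a * a⁻¹ = 1 := mul_inv_cancel₀ ha.ne'
    have hbb : b * b⁻¹ = 1 := mul_inv_cancel₀ hb.ne'
    linear_combination ((1 - δ) ^ 2 * p z i ^ 2 - 2 * (1 - δ) * p z i * ε * A * ψ * w i) * hab
      - 2 * (1 - δ) * p z i * ε * A * ψ * z i * haa
      + 2 * (1 - δ) * p z i * ε * A * ψ * z i * hbb
  have hnn : 0 ≤ δ * (1 - δ) * ∑ i, p z i ^ 2 :=
    mul_nonneg (mul_nonneg hδ (by linarith)) (Finset.sum_nonneg fun i _ => sq_nonneg _)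
  rw [hgw]
  have hlam : a * lam + b * lam = lam := by rw [← add_mul, hab, one_mul]
  linarith

theorem deriv_nonpos_of_le_left {g : ℝ → ℝ} {c : ℝ} (hg : HasDerivAt g c 0)
    (h : ∀ t ∈ Icc (0 : ℝ) 1, g t ≤ g 0) : c ≤ 0 := by
  have hmax : IsLocalMaxOn g (Icc 0 1) 0 := eventually_nhdsWithin_of_forall h
  have h1 : (1 : ℝ) ∈ posTangentConeAt (Icc (0 : ℝ) 1) 0 := by
    apply mem_posTangentConeAt_of_segment_subset
    rw [zero_add, segment_eq_Icc zero_le_one]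
  simpa using hmax.hasFDerivWithinAt_nonpos hg.hasFDerivAt.hasFDerivWithinAt h1

theorem infDist_frontier_pos {E : Type*} [NormedAddCommGroup E] [NormedSpace ℝ E]
    {Ω : Set E} (hΩ : IsOpen Ω) (hfr : (frontier Ω).Nonempty) {x : E} (hx : x ∈ Ω) :
    0 < infDist x (frontier Ω) := by
  refine (isClosed_frontier.notMem_iff_infDist_pos hfr).1 fun h => ?_
  rw [hΩ.frontier_eq] at h; exact h.2 hx

theorem one_le_sum_sq_fderiv_infDist {n : ℕ} {s : Set (EuclideanSpace ℝ (Fin n))}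
    (hs : IsClosed s) (hne : s.Nonempty) {x : EuclideanSpace ℝ (Fin n)}
    (hx : 0 < infDist x s) (hd : DifferentiableAt ℝ (fun y => infDist y s) x) :
    1 ≤ ∑ i, (fderiv ℝ (fun y => infDist y s) x (EuclideanSpace.single i 1)) ^ 2 := by
  obtain ⟨p, hp, hpd⟩ := hs.exists_infDist_eq_dist hne x
  set D := infDist x s with hD
  set L := fderiv ℝ (fun y => infDist y s) x with hL
  have hnorm : ‖p - x‖ = D := by rw [hpd, dist_comm, dist_eq_norm]
  have hslope : L (p - x) ≤ -D := by
    have hl : HasDerivAt (fun t : ℝ => x + t • (p - x)) (p - x) 0 := by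
      simpa using ((hasDerivAt_id (0 : ℝ)).smul_const (p - x)).const_add x
    have h3 : HasFDerivAt (fun y => infDist y s) L (x + (0 : ℝ) • (p - x)) := by
      simpa using hd.hasFDerivAt
    have h4 := (h3.comp_hasDerivAt (0 : ℝ) hl).add ((hasDerivAt_id (0 : ℝ)).mul_const D)
    have := deriv_nonpos_of_le_left h4 fun t ht => by
      have h5 : infDist (x + t • (p - x)) s ≤ (1 - t) * D := by
        refine (infDist_le_dist_of_mem hp).trans_eq ?_
        have : x + t • (p - x) - p = -((1 - t) • (p - x)) := by module
        rw [dist_eq_norm, this, norm_neg, norm_smul, hnorm, Real.norm_of_nonneg (by linarith [ht.2])]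
      simp only [Pi.add_apply, Function.comp_apply, id, zero_smul, add_zero, zero_mul]
      linarith
    linarith
  have hexp : L (p - x) = ∑ i, (p - x) i * L (EuclideanSpace.single i 1) := by
    have : p - x = ∑ i, (p - x) i • EuclideanSpace.single i (1 : ℝ) := by
      simpa [EuclideanSpace.basisFun_repr] using
        ((EuclideanSpace.basisFun (Fin n) ℝ).sum_repr (p - x)).symm
    conv_lhs => rw [this, map_sum]
    simp only [map_smul, smul_eq_mul]
  have hcs := Finset.sum_mul_sq_le_sq_mul_sq Finset.univ (fun i => (p - x) i)
    (fun i => L (EuclideanSpace.single i 1))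
  have hn2 : ∑ i, (p - x) i ^ 2 = D ^ 2 := by
    rw [← hnorm, EuclideanSpace.norm_sq_eq]
    simp only [Real.norm_eq_abs, sq_abs]
  rw [← hexp, hn2] at hcs
  have h6 : D ^ 2 ≤ (L (p - x)) ^ 2 := by nlinarith
  have h7 : D ^ 2 * 1 ≤ D ^ 2 * ∑ i, (L (EuclideanSpace.single i 1)) ^ 2 := by linarith
  exact le_of_mul_le_mul_left h7 (by positivity)

theorem exists_abs_lap_le {n : ℕ} {f : EuclideanSpace ℝ (Fin n) → ℝ}
    {S K : Set (EuclideanSpace ℝ (Fin n))} (hf : ContDiffOn ℝ 2 f S) (hS : UniqueDiffOn ℝ S)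
    (hK : IsCompact K) (hKS : K ⊆ S) : ∃ C, ∀ x ∈ K, x ∈ interior S → |lap f x| ≤ C := by
  have h1 : ∀ i : Fin n, ContDiffOn ℝ 1
      (fun y => fderivWithin ℝ f S y (EuclideanSpace.single i 1)) S := fun i =>
    (hf.fderivWithin hS (by norm_num)).clm_apply contDiffOn_const
  have h2 : ContinuousOn (fun x => ∑ i : Fin n,
      fderivWithin ℝ (fun y => fderivWithin ℝ f S y (EuclideanSpace.single i 1)) S x
        (EuclideanSpace.single i 1)) S :=
    continuousOn_finsetSum _ fun i _ =>
      ((h1 i).continuousOn_fderivWithin hS le_rfl).clm_apply continuousOn_const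
  obtain ⟨C, hC⟩ := hK.exists_bound_of_continuousOn (h2.mono hKS)
  refine ⟨C, fun x hx hxi => ?_⟩
  have h3 : lap f x = ∑ i : Fin n,
      fderivWithin ℝ (fun y => fderivWithin ℝ f S y (EuclideanSpace.single i 1)) S x
        (EuclideanSpace.single i 1) := by
    refine Finset.sum_congr rfl fun i _ => ?_
    rw [fderivWithin_of_mem_nhds (mem_interior_iff_mem_nhds.1 hxi)]
    have : (fun y => fderiv ℝ f y (EuclideanSpace.single i 1)) =ᶠ[𝓝 x]
        fun y => fderivWithin ℝ f S y (EuclideanSpace.single i 1) := by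
      filter_upwards [isOpen_interior.mem_nhds hxi] with y hy
      rw [fderivWithin_of_mem_nhds (mem_interior_iff_mem_nhds.1 hy)]
    rw [this.fderiv_eq]
  rw [h3]; exact hC x hx

/-- Minimum principle: at an interior local minimum of `φ - c (d + A d²)` the Laplacian is
nonnegative. -/
theorem lap_barrier_le_of_isLocalMin {n : ℕ} {φ d : EuclideanSpace ℝ (Fin n) → ℝ}
    {U : Set (EuclideanSpace ℝ (Fin n))} (hU : IsOpen U) (hφ : ContDiffOn ℝ 2 φ U)
    (hd : ContDiffOn ℝ 2 d U) {x : EuclideanSpace ℝ (Fin n)} (hx : x ∈ U) {c A : ℝ}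
    (hmin : IsLocalMin (fun y => φ y - c * (d y + A * d y ^ 2)) x) :
    c * ((1 + 2 * A * d x) * lap d x
      + 2 * A * ∑ i, (fderiv ℝ d x (EuclideanSpace.single i 1)) ^ 2) ≤ lap φ x := by
  have key : ∀ i : Fin n,
      c * ((1 + 2 * A * d x) * fderiv ℝ (fun y => fderiv ℝ d y (EuclideanSpace.single i 1)) x
          (EuclideanSpace.single i 1)
        + 2 * A * (fderiv ℝ d x (EuclideanSpace.single i 1)) ^ 2)
        - fderiv ℝ (fun y => fderiv ℝ φ y (EuclideanSpace.single i 1)) x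
          (EuclideanSpace.single i 1) ≤ 0 := by
    intro i
    set e : EuclideanSpace ℝ (Fin n) := EuclideanSpace.single i 1
    have hc : Tendsto (fun t : ℝ => x + t • e) (𝓝 0) (𝓝 x) := by
      have : Continuous fun t : ℝ => x + t • e := by fun_prop
      simpa using this.tendsto 0
    refine second_deriv_nonpos_of_isLocalMax
      (g := fun t => c * (d (x + t • e) + A * (d (x + t • e) * d (x + t • e))) - φ (x + t • e))
      (g' := fun t => c * (fderiv ℝ d (x + t • e) e + A * (fderiv ℝ d (x + t • e) e * d (x + t • e)
        + d (x + t • e) * fderiv ℝ d (x + t • e) e)) - fderiv ℝ φ (x + t • e) e) ?_ ?_ ?_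
    · filter_upwards [eventually_hasDerivAt_line hU hφ hx e,
        eventually_hasDerivAt_line hU hd hx e] with t h1 h2
      exact ((h2.2.add ((h2.2.mul h2.2).const_mul A)).const_mul c).sub h1.2
    · have h1 := hasDerivAt_fderiv_line hU hφ hx e
      have h2 := hasDerivAt_fderiv_line hU hd hx e
      have h3 := (eventually_hasDerivAt_line hU hd hx e).self_of_nhds.2
      have h4 := ((h2.add (((h2.mul h3).add (h3.mul h2)).const_mul A)).const_mul c).sub h1
      simp only [zero_smul, add_zero] at h4
      refine h4.congr_deriv ?_
      ring
    · filter_upwards [hc.eventually hmin] with t ht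
      simp only [zero_smul, add_zero]
      nlinarith
  have h := Finset.sum_nonpos fun i (_ : i ∈ Finset.univ) => key i
  simp only [Finset.sum_sub_distrib, ← Finset.mul_sum, Finset.sum_add_distrib] at h
  simp only [lap]
  linarith

/-- Hopf's lemma: a positive solution of the Dirichlet problem is bounded below by a multiple of
the distance to the boundary. -/
theorem exists_mul_infDist_frontier_le {n : ℕ} {Ω : Set (EuclideanSpace ℝ (Fin n))}
    (hΩ : IsOpen Ω) (hne : Ω.Nonempty) (hbdd : Bornology.IsBounded Ω) (hconv : Convex ℝ Ω)
    (hfr : (frontier Ω).Nonempty) {r₀ : ℝ} (hr₀ : 0 < r₀)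
    (hsmooth : ContDiffOn ℝ 2 (fun x => infDist x (frontier Ω))
      {x ∈ closure Ω | infDist x (frontier Ω) ≤ r₀})
    {V φ : EuclideanSpace ℝ (Fin n) → ℝ} {lam : ℝ} (hV : ContinuousOn V (closure Ω))
    (hφc : ContinuousOn φ (closure Ω)) (hφ : ContDiffOn ℝ 2 φ Ω) (hpos : ∀ x ∈ Ω, 0 < φ x)
    (hbd : ∀ x ∈ frontier Ω, φ x = 0) (heig : ∀ x ∈ Ω, -lap φ x + V x * φ x = lam * φ x) :
    ∃ κ > 0, ∀ x ∈ Ω, κ * infDist x (frontier Ω) ≤ φ x := by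
  set d : EuclideanSpace ℝ (Fin n) → ℝ := fun x => infDist x (frontier Ω) with hd
  have hdc : Continuous d := continuous_infDist_pt _
  have hd0 : ∀ x, 0 ≤ d x := fun x => infDist_nonneg
  have hdfr : ∀ x ∈ frontier Ω, d x = 0 := fun x hx => infDist_zero_of_mem hx
  have hdpos : ∀ x ∈ Ω, 0 < d x := fun x hx => infDist_frontier_pos hΩ hfr hx
  have hcomp : IsCompact (closure Ω) := hbdd.isCompact_closure
  have hmemΩ : ∀ x ∈ closure Ω, 0 < d x → x ∈ Ω := by
    intro x hx hdx
    by_contra hxΩ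
    have : x ∈ frontier Ω := by rw [hΩ.frontier_eq]; exact ⟨hx, hxΩ⟩
    rw [hdfr x this] at hdx; exact lt_irrefl _ hdx
  set S : Set (EuclideanSpace ℝ (Fin n)) := closure Ω ∩ {x | d x < r₀} with hS
  set U : Set (EuclideanSpace ℝ (Fin n)) := Ω ∩ {x | d x < r₀} with hU
  have hopen : IsOpen {x | d x < r₀} := isOpen_lt hdc continuous_const
  have hUo : IsOpen U := hΩ.inter hopen
  have hUS : U ⊆ S := inter_subset_inter_left _ subset_closure
  have hUi : U ⊆ interior S := interior_maximal hUS hUo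
  have hdS : ContDiffOn ℝ 2 d S := hsmooth.mono fun x hx => ⟨hx.1, hx.2.le⟩
  have huniq : UniqueDiffOn ℝ S := by
    refine (uniqueDiffOn_convex hconv.closure ?_).inter hopen
    exact hne.mono (interior_maximal subset_closure hΩ)
  obtain ⟨C, hC⟩ := exists_abs_lap_le hdS huniq
    (K := closure Ω ∩ {x | d x ≤ r₀ / 2}) (hcomp.inter_right (isClosed_le hdc continuous_const))
    (fun x hx => ⟨hx.1, lt_of_le_of_lt hx.2 (half_lt_self hr₀)⟩)
  obtain ⟨K, hK⟩ := hcomp.exists_bound_of_continuousOn (hV.sub (continuousOn_const (c := lam)))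
  obtain ⟨B, hB⟩ := hcomp.exists_bound_of_continuousOn hdc.continuousOn
  set C' := max C 0
  set K' := max K 0
  have hC0 : 0 ≤ C' := le_max_right _ _
  have hK0 : 0 ≤ K' := le_max_right _ _
  set A := K' + C' + 1 with hA
  have hA1 : 1 ≤ A := by linarith
  set r := min (r₀ / 2) (1 / (2 * A)) with hr
  have hrpos : 0 < r := by positivity
  have hr1 : r ≤ r₀ / 2 := min_le_left _ _
  have hAr : A * r ≤ 1 / 2 := by
    calc A * r ≤ A * (1 / (2 * A)) := mul_le_mul_of_nonneg_left (min_le_right _ _) (by linarith)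
      _ = 1 / 2 := by field_simp
  have hrle : r ≤ 1 / 2 := by nlinarith
  obtain ⟨μ, hμ, hμφ⟩ := (hcomp.inter_right (isClosed_le continuous_const hdc :
    IsClosed {x | r ≤ d x})).exists_forall_le' (hφc.mono inter_subset_left) (a := 0)
    (fun x hx => hpos x (hmemΩ x hx.1 (hrpos.trans_le hx.2)))
  set c := μ / (2 * (r + A * r ^ 2)) with hc
  have hcpos : 0 < c := by positivity
  have hcμ : c * (r + A * r ^ 2) < μ := by
    have : c * (r + A * r ^ 2) = μ / 2 := by rw [hc]; field_simp
    linarith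
  have hcollar : ∀ x ∈ closure Ω, d x ≤ r → 0 ≤ φ x - c * (d x + A * d x ^ 2) := by
    obtain ⟨y, hy, hymin⟩ := (hcomp.inter_right (isClosed_le hdc continuous_const :
      IsClosed {x | d x ≤ r})).exists_isMinOn
      (hfr.mono fun x hx => ⟨frontier_subset_closure hx, by rw [mem_ofPred_eq, hdfr x hx]; exact hrpos.le⟩)
      (f := fun x => φ x - c * (d x + A * d x ^ 2))
      ((hφc.mono inter_subset_left).sub (by fun_prop))
    suffices h : 0 ≤ φ y - c * (d y + A * d y ^ 2) from fun x hx hxr => h.trans (hymin ⟨hx, hxr⟩)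
    by_contra! hneg
    have hdy : 0 < d y := by
      refine (hd0 y).lt_of_ne fun h0 => ?_
      have hyfr : y ∈ frontier Ω := by
        by_contra hyf
        rw [hΩ.frontier_eq] at hyf
        have : y ∈ Ω := by by_contra h; exact hyf ⟨hy.1, h⟩
        exact (hdpos y this).ne h0
      rw [hbd y hyfr, hdfr y hyfr] at hneg
      simp at hneg
    have hyΩ : y ∈ Ω := hmemΩ y hy.1 hdy
    have hyr : d y < r := by
      refine lt_of_le_of_ne hy.2 fun h => ?_
      have := hμφ y ⟨hy.1, h.ge⟩
      rw [h] at hneg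
      linarith
    have hyU : y ∈ U := ⟨hyΩ, show d y < r₀ by linarith⟩
    have hloc : IsLocalMin (fun x => φ x - c * (d x + A * d x ^ 2)) y := by
      filter_upwards [hΩ.mem_nhds hyΩ, (isOpen_lt hdc continuous_const).mem_nhds hyr] with x h1 h2
      exact hymin ⟨subset_closure h1, le_of_lt h2⟩
    have hlap := lap_barrier_le_of_isLocalMin hUo (hφ.mono inter_subset_left) (hdS.mono hUS) hyU hloc
    have hgrad := one_le_sum_sq_fderiv_infDist isClosed_frontier hfr hdy
      (((hdS.mono hUS).contDiffAt (hUo.mem_nhds hyU)).differentiableAt (by norm_num))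
    have hlapd : -C' ≤ lap d y := by
      have h1 := hC y ⟨hy.1, show d y ≤ r₀ / 2 by linarith⟩ (hUi hyU)
      have h2 := neg_abs_le (lap d y)
      have h3 : C ≤ C' := le_max_left _ _
      linarith
    have hφlap : lap φ y ≤ K' * φ y := by
      have h1 := heig y hyΩ
      have h2 : V y - lam ≤ K' := ((le_abs_self _).trans (hK y hy.1)).trans (le_max_left _ _)
      nlinarith [hpos y hyΩ]
    have hAd : A * d y ≤ 1 / 2 := (mul_le_mul_of_nonneg_left hyr.le (by linarith)).trans hAr
    have h1 : lap φ y ≤ c * (K' * (d y + A * d y ^ 2)) := by nlinarith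
    have h2 := le_of_mul_le_mul_left (hlap.trans h1) hcpos
    have h3 : d y + A * d y ^ 2 ≤ 1 := by nlinarith
    have h4 : K' * (d y + A * d y ^ 2) ≤ K' := mul_le_of_le_one_right hK0 h3
    have h5 : -(2 * C') ≤ (1 + 2 * A * d y) * lap d y := by
      have h6 : 0 ≤ A * d y := by positivity
      nlinarith
    have h6 : 2 * A ≤ 2 * A * ∑ i, (fderiv ℝ d y (EuclideanSpace.single i 1)) ^ 2 :=
      le_mul_of_one_le_right (by linarith) hgrad
    linarith
  have hB0 : 0 < |B| + 1 := by positivity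
  refine ⟨min c (μ / (|B| + 1)), by positivity, fun x hx => ?_⟩
  have hxd := hdpos x hx
  rcases le_or_gt (d x) r with h | h
  · have h1 := hcollar x (subset_closure hx) h
    have h2 : min c (μ / (|B| + 1)) * d x ≤ c * d x :=
      mul_le_mul_of_nonneg_right (min_le_left _ _) hxd.le
    have h3 : 0 ≤ c * (A * d x ^ 2) := by positivity
    change min c (μ / (|B| + 1)) * d x ≤ φ x
    linarith
  · have h1 := hμφ x ⟨subset_closure hx, h.le⟩
    refine le_trans ?_ h1
    have h2 : d x ≤ |B| + 1 := by
      have := (le_abs_self _).trans ((hB x (subset_closure hx)).trans (le_abs_self B))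
      linarith
    calc min c (μ / (|B| + 1)) * d x ≤ μ / (|B| + 1) * (|B| + 1) :=
          mul_le_mul (min_le_right _ _) h2 hxd.le (by positivity)
      _ = μ := by field_simp

theorem exists_lipschitz_fderivWithin {E : Type*} [NormedAddCommGroup E] [NormedSpace ℝ E]
    {s : Set E} {f : E → ℝ} (hs : Convex ℝ s) (hc : IsCompact s) (hu : UniqueDiffOn ℝ s)
    (hf : ContDiffOn ℝ 2 f s) :
    ∃ C, 0 ≤ C ∧ (∀ x ∈ s, ‖fderivWithin ℝ f s x‖ ≤ C) ∧
      ∀ x ∈ s, ∀ y ∈ s, ‖fderivWithin ℝ f s y - fderivWithin ℝ f s x‖ ≤ C * ‖y - x‖ := by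
  have h1 : ContDiffOn ℝ 1 (fderivWithin ℝ f s) s := hf.fderivWithin hu (by norm_num)
  obtain ⟨C₁, hC₁⟩ := hc.exists_bound_of_continuousOn h1.continuousOn
  obtain ⟨C₂, hC₂⟩ := hc.exists_bound_of_continuousOn (h1.continuousOn_fderivWithin hu le_rfl)
  refine ⟨max (max C₁ C₂) 0, le_max_right _ _,
    fun x hx => (hC₁ x hx).trans ((le_max_left _ _).trans (le_max_left _ _)), fun x hx y hy => ?_⟩
  exact hs.norm_image_sub_le_of_norm_fderivWithin_le (h1.differentiableOn (by norm_num))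
    (fun x hx => (hC₂ x hx).trans ((le_max_right _ _).trans (le_max_left _ _))) hx hy

theorem fderivWithin_nonneg_of_boundary_zero {E : Type*} [NormedAddCommGroup E] [NormedSpace ℝ E]
    {s : Set E} {f : E → ℝ} (hs : Convex ℝ s) (hf : DifferentiableOn ℝ f s)
    (hnn : ∀ x ∈ s, 0 ≤ f x) {p y : E} (hp : p ∈ s) (hp0 : f p = 0) (hy : y ∈ s) :
    0 ≤ fderivWithin ℝ f s p (y - p) := by
  have hmin : IsLocalMinOn f s p :=
    eventually_nhdsWithin_of_forall fun x hx => by rw [hp0]; exact hnn x hx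
  refine hmin.hasFDerivWithinAt_nonneg (hf p hp).hasFDerivWithinAt ?_
  apply mem_posTangentConeAt_of_segment_subset
  rw [add_sub_cancel]
  exact hs.segment_subset hp hy

theorem norm_fderivWithin_mul_infDist_le {E : Type*} [NormedAddCommGroup E] [NormedSpace ℝ E]
    {Ω : Set E} {f : E → ℝ} (hΩ : IsOpen Ω) (hconv : Convex ℝ Ω) (hfr : (frontier Ω).Nonempty)
    (hf : DifferentiableOn ℝ f (closure Ω)) (hnn : ∀ x ∈ closure Ω, 0 ≤ f x)
    {x p : E} (hx : x ∈ Ω) (hp : p ∈ frontier Ω) (hp0 : f p = 0) :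
    ‖fderivWithin ℝ f (closure Ω) p‖ * infDist x (frontier Ω)
      ≤ fderivWithin ℝ f (closure Ω) p (x - p) := by
  set L := fderivWithin ℝ f (closure Ω) p
  set d := infDist x (frontier Ω)
  have hd : 0 < d := infDist_frontier_pos hΩ hfr hx
  have hball : closedBall x d ⊆ closure Ω := by
    rw [← closure_ball x hd.ne']
    exact closure_mono (ball_infDist_frontier_subset hΩ hx)
  have hpc := frontier_subset_closure hp
  have hnonneg : ∀ v : E, ‖v‖ ≤ d → 0 ≤ L (x - p) + L v := by
    intro v hv
    have h := fderivWithin_nonneg_of_boundary_zero hconv.closure hf hnn hpc hp0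
      (hball (show x + v ∈ closedBall x d by simpa using hv))
    rwa [add_sub_right_comm, map_add] at h
  have h0 : 0 ≤ L (x - p) := by simpa using hnonneg 0 (by simpa using hd.le)
  rw [← le_div_iff₀ hd]
  refine L.opNorm_le_bound (by positivity) fun v => ?_
  rcases eq_or_ne v 0 with rfl | hv
  · simp
  have hvn : 0 < ‖v‖ := norm_pos_iff.2 hv
  have hn : ‖(d / ‖v‖) • v‖ ≤ d := by
    rw [norm_smul, Real.norm_of_nonneg (by positivity), div_mul_cancel₀ _ hvn.ne']
  have h1 := hnonneg _ hn
  have h2 := hnonneg (-((d / ‖v‖) • v)) (by rwa [norm_neg])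
  rw [map_neg] at h2
  rw [map_smul, smul_eq_mul] at h1 h2
  have h3 : |d / ‖v‖ * L v| ≤ L (x - p) := abs_le.2 ⟨by linarith, by linarith⟩
  rw [abs_mul, abs_of_pos (by positivity)] at h3
  rw [Real.norm_eq_abs]
  calc |L v| = (d / ‖v‖ * |L v|) / d * ‖v‖ := by field_simp
    _ ≤ L (x - p) / d * ‖v‖ := by gcongr

theorem abs_sub_norm_fderivWithin_mul_infDist_le {E : Type*} [NormedAddCommGroup E]
    [NormedSpace ℝ E] [ProperSpace E]
    {Ω : Set E} {f : E → ℝ} (hΩ : IsOpen Ω) (hconv : Convex ℝ Ω) (hfr : (frontier Ω).Nonempty)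
    (hf : DifferentiableOn ℝ f (closure Ω)) (hnn : ∀ x ∈ closure Ω, 0 ≤ f x)
    (hbd : ∀ x ∈ frontier Ω, f x = 0) {C : ℝ} (hC0 : 0 ≤ C)
    (hC : ∀ x ∈ closure Ω, ∀ y ∈ closure Ω,
      ‖fderivWithin ℝ f (closure Ω) y - fderivWithin ℝ f (closure Ω) x‖ ≤ C * ‖y - x‖)
    {x : E} (hx : x ∈ Ω) :
    |f x - ‖fderivWithin ℝ f (closure Ω) x‖ * infDist x (frontier Ω)|
      ≤ 3 * C * infDist x (frontier Ω) ^ 2 := by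
  obtain ⟨p, hp, hpd⟩ := isClosed_frontier.exists_infDist_eq_dist hfr x
  have hlow := norm_fderivWithin_mul_infDist_le hΩ hconv hfr hf hnn hx hp (hbd p hp)
  set F := fderivWithin ℝ f (closure Ω)
  set d := infDist x (frontier Ω)
  have hd0 : 0 ≤ d := infDist_nonneg
  have hn : ‖x - p‖ = d := by rw [hpd, dist_eq_norm]
  have hxc := subset_closure hx
  have hpc := frontier_subset_closure hp
  have hseg : segment ℝ p x ⊆ closure Ω := hconv.closure.segment_subset hpc hxc
  have hmv := (convex_segment p x).norm_image_sub_le_of_norm_hasFDerivWithin_le'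
    (f := f) (f' := F) (φ := F x) (C := C * d)
    (fun ξ hξ => (hf ξ (hseg hξ)).hasFDerivWithinAt.mono hseg)
    (fun ξ hξ => by
      refine (hC x hxc ξ (hseg hξ)).trans (mul_le_mul_of_nonneg_left ?_ hC0)
      have := norm_sub_le_of_mem_segment (segment_symm ℝ p x ▸ hξ)
      rw [← hn, norm_sub_rev x p]
      exact this)
    (left_mem_segment ℝ p x) (right_mem_segment ℝ p x)
  rw [hbd p hp, sub_zero, hn, Real.norm_eq_abs, abs_le] at hmv
  have hFp := hC p hpc x hxc
  rw [hn] at hFp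
  have h1 : F x (x - p) ≤ ‖F x‖ * d := by
    rw [← hn]; exact (le_abs_self _).trans ((F x).le_opNorm _)
  have h2 : |F x (x - p) - F p (x - p)| ≤ C * d * d := by
    rw [← sub_apply, ← Real.norm_eq_abs]
    refine ((F x - F p).le_opNorm _).trans ?_
    rw [hn]; gcongr
  have h3 : ‖F x‖ - ‖F p‖ ≤ C * d := (norm_sub_norm_le _ _).trans hFp
  rw [abs_le] at h2 ⊢
  have h4 : (‖F x‖ - ‖F p‖) * d ≤ C * d * d := mul_le_mul_of_nonneg_right h3 hd0
  have h5 : 0 ≤ C * d * d := by positivity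
  constructor <;> nlinarith [h2.1, h2.2, hmv.1, hmv.2]

theorem neg_mul_infDist_le_fderivWithin {E : Type*} [NormedAddCommGroup E]
    [NormedSpace ℝ E] [ProperSpace E]
    {Ω : Set E} {f : E → ℝ} (hconv : Convex ℝ Ω) (hfr : (frontier Ω).Nonempty)
    (hf : DifferentiableOn ℝ f (closure Ω)) (hnn : ∀ x ∈ closure Ω, 0 ≤ f x)
    (hbd : ∀ x ∈ frontier Ω, f x = 0) {C : ℝ}
    (hCb : ∀ x ∈ closure Ω, ‖fderivWithin ℝ f (closure Ω) x‖ ≤ C)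
    (hC : ∀ x ∈ closure Ω, ∀ y ∈ closure Ω,
      ‖fderivWithin ℝ f (closure Ω) y - fderivWithin ℝ f (closure Ω) x‖ ≤ C * ‖y - x‖)
    {x z : E} (hx : x ∈ closure Ω) (hz : z ∈ closure Ω) :
    -(C * (1 + ‖x - z‖) * infDist z (frontier Ω)) ≤ fderivWithin ℝ f (closure Ω) z (x - z) := by
  obtain ⟨p, hp, hpd⟩ := isClosed_frontier.exists_infDist_eq_dist hfr z
  have hpc := frontier_subset_closure hp
  have h0 := fderivWithin_nonneg_of_boundary_zero hconv.closure hf hnn hpc (hbd p hp) hx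
  set F := fderivWithin ℝ f (closure Ω)
  set d := infDist z (frontier Ω)
  have hn : ‖z - p‖ = d := by rw [hpd, dist_eq_norm]
  have h1 : |F z (x - z) - F p (x - z)| ≤ C * d * ‖x - z‖ := by
    rw [← sub_apply, ← Real.norm_eq_abs, ← hn]
    refine ((F z - F p).le_opNorm _).trans ?_
    exact mul_le_mul_of_nonneg_right (hC p hpc z hz) (norm_nonneg _)
  have h2 : F p (z - p) ≤ C * d := by
    rw [← hn]
    exact (le_abs_self _).trans (((F p).le_opNorm _).trans
      (mul_le_mul_of_nonneg_right (hCb p hpc) (norm_nonneg _)))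
  have h3 : F p (x - p) = F p (x - z) + F p (z - p) := by rw [← map_add]; congr 1; abel
  have h4 := (abs_le.1 h1).1
  linarith

/-- The logarithm of a function comparable to the distance to the boundary differs from the
logarithm of the distance by a function which is continuous up to the boundary. -/
theorem exists_continuousOn_log_eq {E : Type*} [NormedAddCommGroup E]
    [NormedSpace ℝ E] [ProperSpace E]
    {Ω : Set E} {f : E → ℝ} (hΩ : IsOpen Ω) (hconv : Convex ℝ Ω) (hfr : (frontier Ω).Nonempty)
    (hf : DifferentiableOn ℝ f (closure Ω)) (hnn : ∀ x ∈ closure Ω, 0 ≤ f x)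
    (hbd : ∀ x ∈ frontier Ω, f x = 0) {C : ℝ} (hC0 : 0 ≤ C)
    (hC : ∀ x ∈ closure Ω, ∀ y ∈ closure Ω,
      ‖fderivWithin ℝ f (closure Ω) y - fderivWithin ℝ f (closure Ω) x‖ ≤ C * ‖y - x‖)
    {κ : ℝ} (hκ : 0 < κ) (hκf : ∀ x ∈ Ω, κ * infDist x (frontier Ω) ≤ f x) :
    ∃ Q : E → ℝ, ContinuousOn Q (closure Ω) ∧
      ∀ x ∈ Ω, Real.log (f x) = Real.log (infDist x (frontier Ω)) + Q x := by
  classical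
  set d : E → ℝ := fun x => infDist x (frontier Ω) with hd
  have hdc : Continuous d := continuous_infDist_pt _
  have hdpos : ∀ x ∈ Ω, 0 < d x := fun x hx => infDist_frontier_pos hΩ hfr hx
  set F := fderivWithin ℝ f (closure Ω) with hF
  have hFc : ContinuousOn F (closure Ω) := by
    intro x hx
    have h1 : Tendsto (fun y => C * ‖y - x‖) (𝓝[closure Ω] x) (𝓝 0) := by
      have : Continuous fun y => C * ‖y - x‖ := by fun_prop
      simpa using (this.tendsto x).mono_left nhdsWithin_le_nhds
    refine tendsto_iff_norm_sub_tendsto_zero.2 (squeeze_zero' (Eventually.of_forall fun y =>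
      norm_nonneg _) ?_ h1)
    exact eventually_nhdsWithin_of_forall fun y hy => hC x hx y hy
  set k : E → ℝ := fun x => if x ∈ Ω then f x / d x else ‖F x‖ with hk
  have hkF : ∀ x ∈ closure Ω, ‖k x - ‖F x‖‖ ≤ 3 * C * d x := by
    intro x hx
    by_cases hxΩ : x ∈ Ω
    · have h := abs_sub_norm_fderivWithin_mul_infDist_le hΩ hconv hfr hf hnn hbd hC0 hC hxΩ
      have hdx := hdpos x hxΩ
      have : k x - ‖F x‖ = (f x - ‖F x‖ * d x) / d x := by
        simp only [hk, if_pos hxΩ]; field_simp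
      rw [this, Real.norm_eq_abs, abs_div, abs_of_pos hdx, div_le_iff₀ hdx]
      calc _ ≤ _ := h
        _ = _ := by ring
    · simp only [hk, if_neg hxΩ, sub_self, norm_zero]
      have : 0 ≤ d x := infDist_nonneg
      positivity
  have hkc : ContinuousOn k (closure Ω) := by
    intro x hx
    by_cases hxΩ : x ∈ Ω
    · have h1 : ContinuousAt (fun y => f y / d y) x :=
        (((hf x hx).continuousWithinAt).continuousAt
          (mem_of_superset (hΩ.mem_nhds hxΩ) subset_closure)).div hdc.continuousAt (hdpos x hxΩ).ne'
      refine (h1.congr ?_).continuousWithinAt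
      filter_upwards [hΩ.mem_nhds hxΩ] with y hy
      simp only [hk, if_pos hy]
    · have hxfr : x ∈ frontier Ω := by rw [hΩ.frontier_eq]; exact ⟨hx, hxΩ⟩
      have h1 : Tendsto (fun y => 3 * C * d y) (𝓝[closure Ω] x) (𝓝 0) := by
        have h2 : Continuous fun y => 3 * C * d y := by fun_prop
        have h3 : d x = 0 := infDist_zero_of_mem hxfr
        simpa [h3] using (h2.tendsto x).mono_left nhdsWithin_le_nhds
      have h2 : Tendsto (fun y => k y - ‖F y‖) (𝓝[closure Ω] x) (𝓝 0) :=
        squeeze_zero_norm' (eventually_nhdsWithin_of_forall hkF) h1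
      have h3 := h2.add (hFc x hx).norm
      simp only [sub_add_cancel, zero_add] at h3
      have h4 : k x = ‖F x‖ := by simp only [hk, if_neg hxΩ]
      rw [ContinuousWithinAt, h4]; exact h3
  refine ⟨fun x => Real.log (max (k x) κ), ?_, fun x hx => ?_⟩
  · exact (hkc.sup continuousOn_const).log fun x _ => (hκ.trans_le (le_max_right _ _)).ne'
  · have hdx := hdpos x hx
    have hkx : k x = f x / d x := by simp only [hk, if_pos hx]
    have h1 : κ ≤ k x := by rw [hkx, le_div_iff₀ hdx]; exact hκf x hx
    have hfx : 0 < f x := (mul_pos hκ hdx).trans_le (hκf x hx)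
    change Real.log (f x) = Real.log (d x) + Real.log (max (k x) κ)
    rw [max_eq_left h1, hkx, ← Real.log_mul hdx.ne' (div_pos hfx hdx).ne', mul_div_cancel₀ _ hdx.ne']

theorem combo_log_infDist_le {E : Type*} [NormedAddCommGroup E] [NormedSpace ℝ E]
    {Ω : Set E} (hΩ : IsOpen Ω) (hconv : Convex ℝ Ω) (hfr : (frontier Ω).Nonempty)
    {x y : E} (hx : x ∈ Ω) (hy : y ∈ Ω) {a b : ℝ} (ha : 0 < a) (hb : 0 < b) (hab : a + b = 1) :
    a * Real.log (infDist x (frontier Ω)) + b * Real.log (infDist y (frontier Ω))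
      ≤ Real.log (infDist (a • x + b • y) (frontier Ω)) := by
  have hdx := infDist_frontier_pos hΩ hfr hx
  have hdy := infDist_frontier_pos hΩ hfr hy
  refine (strictConcaveOn_log_Ioi.concaveOn.2 hdx hdy ha.le hb.le hab).trans ?_
  exact Real.log_le_log (by simp only [smul_eq_mul]; positivity)
    (infDist_frontier_combo_le hΩ hconv hfr hx hy ha hb hab)

/-- The perturbed two-point concavity function attains its maximum inside `Ω × Ω`. -/
theorem exists_isLocalMax_two_point {E : Type*} [NormedAddCommGroup E] [NormedSpace ℝ E]
    [ProperSpace E] {Ω : Set E} (hΩ : IsOpen Ω) (hbdd : Bornology.IsBounded Ω)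
    (hconv : Convex ℝ Ω) (hfr : (frontier Ω).Nonempty) {ℓ Q : E → ℝ} (hℓ : ContinuousOn ℓ Ω)
    (hQ : ∀ x ∈ Ω, ℓ x = Real.log (infDist x (frontier Ω)) + Q x) {q : ℝ}
    (hq : ∀ x ∈ Ω, |Q x| ≤ q) {W : E × E → ℝ} (hW : Continuous W) {H : ℝ}
    (hWH : ∀ x ∈ Ω, ∀ y ∈ Ω, W (x, y) ≤ H) {a b δ : ℝ} (ha : 0 < a) (hb : 0 < b)
    (hab : a + b = 1) (hδ : 0 < δ) (hδ1 : δ ≤ 1) {x₁ y₁ : E} (hx₁ : x₁ ∈ Ω) (hy₁ : y₁ ∈ Ω)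
    {Φ : E × E → ℝ}
    (hΦ : Φ = fun p => a * ℓ p.1 + b * ℓ p.2 - (1 - δ) * ℓ (a • p.1 + b • p.2) + W p) :
    ∃ x ∈ Ω, ∃ y ∈ Ω, IsLocalMax Φ (x, y) ∧ Φ (x₁, y₁) ≤ Φ (x, y) := by
  have hdc : Continuous fun x : E => infDist x (frontier Ω) := continuous_infDist_pt _
  have hcomp : IsCompact (closure Ω) := hbdd.isCompact_closure
  obtain ⟨D, hD⟩ := hcomp.exists_bound_of_continuousOn hdc.continuousOn
  have hlogD : ∀ x ∈ Ω, Real.log (infDist x (frontier Ω)) ≤ Real.log D := fun x hx =>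
    Real.log_le_log (infDist_frontier_pos hΩ hfr hx)
      ((le_abs_self _).trans (hD x (subset_closure hx)))
  have hzΩ : ∀ x ∈ Ω, ∀ y ∈ Ω, a • x + b • y ∈ Ω := fun x hx y hy =>
    hconv hx hy ha.le hb.le hab
  set T := (2 * q + H - Φ (x₁, y₁)) / δ with hT
  have hlow : ∀ x ∈ Ω, ∀ y ∈ Ω, Φ (x₁, y₁) ≤ Φ (x, y) →
      -T ≤ a * Real.log (infDist x (frontier Ω)) + b * Real.log (infDist y (frontier Ω)) := by
    intro x hx y hy h
    have h1 := combo_log_infDist_le hΩ hconv hfr hx hy ha hb hab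
    set ld := a * Real.log (infDist x (frontier Ω)) + b * Real.log (infDist y (frontier Ω)) with hld
    have hz := hzΩ x hx y hy
    have h2 : Φ (x, y) ≤ δ * ld + 2 * q + H := by
      have hqx := (abs_le.1 (hq x hx)).2
      have hqy := (abs_le.1 (hq y hy)).2
      have hqz := (abs_le.1 (hq _ hz)).1
      have hq0 : 0 ≤ q := (abs_nonneg _).trans (hq x hx)
      have hW' := hWH x hx y hy
      have e1 : a * Q x + b * Q y ≤ q := by
        calc a * Q x + b * Q y ≤ a * q + b * q := by gcongr
          _ = q := by rw [← add_mul, hab, one_mul]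
      have e2 : (1 - δ) * ld ≤ (1 - δ) * Real.log (infDist (a • x + b • y) (frontier Ω)) :=
        mul_le_mul_of_nonneg_left h1 (by linarith)
      have e3 : (1 - δ) * (-q) ≤ (1 - δ) * Q (a • x + b • y) :=
        mul_le_mul_of_nonneg_left hqz (by linarith)
      have e4 : 0 ≤ δ * q := by positivity
      simp only [hΦ]
      rw [hQ x hx, hQ y hy, hQ _ hz]
      linarith
    have h3 : (Φ (x₁, y₁) - 2 * q - H) / δ ≤ ld := by
      rw [div_le_iff₀ hδ]; linarith
    calc -T = (Φ (x₁, y₁) - 2 * q - H) / δ := by rw [hT]; ring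
      _ ≤ ld := h3
  set ρ := min (Real.exp ((-T - b * Real.log D) / a)) (Real.exp ((-T - a * Real.log D) / b)) with hρ
  have hρ0 : 0 < ρ := lt_min (Real.exp_pos _) (Real.exp_pos _)
  set K : Set E := closure Ω ∩ {x | ρ ≤ infDist x (frontier Ω)} with hK
  have hKΩ : K ⊆ Ω := by
    intro x hx
    by_contra hxΩ
    have hxf : x ∈ frontier Ω := by rw [hΩ.frontier_eq]; exact ⟨hx.1, hxΩ⟩
    have h1 : ρ ≤ infDist x (frontier Ω) := hx.2
    rw [infDist_zero_of_mem hxf] at h1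
    linarith
  have hKc : IsCompact K := hcomp.inter_right (isClosed_le continuous_const hdc)
  have hmem : ∀ x ∈ Ω, ∀ y ∈ Ω, Φ (x₁, y₁) ≤ Φ (x, y) → (x, y) ∈ K ×ˢ K := by
    intro x hx y hy h
    have h1 := hlow x hx y hy h
    have hlx := mul_le_mul_of_nonneg_left (hlogD x hx) ha.le
    have hly := mul_le_mul_of_nonneg_left (hlogD y hy) hb.le
    have hxK : ρ ≤ infDist x (frontier Ω) := by
      refine (min_le_left _ _).trans ?_
      rw [← Real.le_log_iff_exp_le (infDist_frontier_pos hΩ hfr hx), div_le_iff₀ ha]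
      linarith
    have hyK : ρ ≤ infDist y (frontier Ω) := by
      refine (min_le_right _ _).trans ?_
      rw [← Real.le_log_iff_exp_le (infDist_frontier_pos hΩ hfr hy), div_le_iff₀ hb]
      linarith
    exact ⟨⟨subset_closure hx, hxK⟩, ⟨subset_closure hy, hyK⟩⟩
  have hcont : ContinuousOn Φ (Ω ×ˢ Ω) := by
    rw [hΦ]
    have c1 : ContinuousOn (fun p : E × E => ℓ p.1) (Ω ×ˢ Ω) :=
      hℓ.comp continuousOn_fst fun p hp => hp.1
    have c2 : ContinuousOn (fun p : E × E => ℓ p.2) (Ω ×ˢ Ω) :=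
      hℓ.comp continuousOn_snd fun p hp => hp.2
    have c3 : ContinuousOn (fun p : E × E => ℓ (a • p.1 + b • p.2)) (Ω ×ˢ Ω) :=
      hℓ.comp (by fun_prop) fun p hp => hzΩ _ hp.1 _ hp.2
    exact (((continuousOn_const.mul c1).add (continuousOn_const.mul c2)).sub
      (continuousOn_const.mul c3)).add hW.continuousOn
  have h₁ := hmem x₁ hx₁ y₁ hy₁ le_rfl
  obtain ⟨⟨x, y⟩, hxy, hmax⟩ := (hKc.prod hKc).exists_isMaxOn ⟨_, h₁⟩
    (hcont.mono (prod_mono hKΩ hKΩ))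
  refine ⟨x, hKΩ hxy.1, y, hKΩ hxy.2, ?_, hmax h₁⟩
  filter_upwards [(hΩ.prod hΩ).mem_nhds (⟨hKΩ hxy.1, hKΩ hxy.2⟩ : (x, y) ∈ Ω ×ˢ Ω)] with p hp
  rcases le_or_gt (Φ (x₁, y₁)) (Φ p) with h | h
  · exact hmax (hmem p.1 hp.1 p.2 hp.2 h)
  · exact h.le.trans (hmax h₁)

theorem exists_small_pos {P T m c : ℝ} (hP : 0 ≤ P) (hT : 0 ≤ T) (hm : 0 < m) (hc : 0 < c) :
    ∃ ε > 0, ε ≤ 1 ∧ ε * P ≤ m ∧ ε * T < c := by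
  refine ⟨min 1 (min (m / (P + 1)) (c / (T + 1))), by positivity, min_le_left _ _, ?_, ?_⟩
  · calc _ ≤ m / (P + 1) * P :=
          mul_le_mul_of_nonneg_right ((min_le_right _ _).trans (min_le_left _ _)) hP
      _ ≤ m := by rw [div_mul_eq_mul_div, div_le_iff₀ (by linarith)]; nlinarith
  · calc _ ≤ c / (T + 1) * T :=
          mul_le_mul_of_nonneg_right ((min_le_right _ _).trans (min_le_right _ _)) hT
      _ < c := by rw [div_mul_eq_mul_div, div_lt_iff₀ (by linarith)]; nlinarith

/-- The maximum-point inequality fails for small perturbations once `A * ‖w‖ ^ 2` is large. -/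
theorem lt_of_perturbation_small {E : Type*} [NormedAddCommGroup E] [NormedSpace ℝ E]
    {z w : E} {a b A ψ H R G g ε K v : ℝ} (ha : 0 < a) (hb : 0 < b) (hA : 0 < A) (hψ : 0 < ψ)
    (hψH : ψ ≤ H) (hHψ : H⁻¹ ≤ ψ) (hw : ‖w‖ ≤ 2 * R) (hz : ‖z‖ ≤ R)
    (hAw : 1 + 2 * G ≤ A * ‖w‖ ^ 2) (hG : 0 ≤ G) (hg : -G ≤ g) (hv : -K ≤ v)
    (hε : 0 < ε) (hε1 : ε ^ 2 ≤ 1)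
    (hsmall : ε * (a * (A * H * (a⁻¹ * R + 2 * R)) ^ 2 + b * (A * H * (2 * R + b⁻¹ * R)) ^ 2 + K)
      < A * H⁻¹) :
    ε ^ 2 * (a * ‖(A * ψ) • (a⁻¹ • z + w)‖ ^ 2 + b * ‖(A * ψ) • (w - b⁻¹ • z)‖ ^ 2)
      < ε * A ^ 2 * ψ * ‖w‖ ^ 2 + 2 * ε * (1 - ε ^ 2) * A * ψ * g + ε ^ 2 * v := by
  have hX : ‖(A * ψ) • (a⁻¹ • z + w)‖ ≤ A * H * (a⁻¹ * R + 2 * R) := by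
    rw [norm_smul, Real.norm_of_nonneg (by positivity)]
    have : ‖a⁻¹ • z + w‖ ≤ a⁻¹ * R + 2 * R := by
      refine (norm_add_le _ _).trans ?_
      rw [norm_smul, Real.norm_of_nonneg (by positivity)]
      gcongr
    have hH : 0 < H := hψ.trans_le hψH
    gcongr
  have hY : ‖(A * ψ) • (w - b⁻¹ • z)‖ ≤ A * H * (2 * R + b⁻¹ * R) := by
    rw [norm_smul, Real.norm_of_nonneg (by positivity)]
    have : ‖w - b⁻¹ • z‖ ≤ 2 * R + b⁻¹ * R := by
      refine (norm_sub_le _ _).trans ?_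
      rw [norm_smul, Real.norm_of_nonneg (by positivity)]
      gcongr
    have hH : 0 < H := hψ.trans_le hψH
    gcongr
  set B := a * (A * H * (a⁻¹ * R + 2 * R)) ^ 2 + b * (A * H * (2 * R + b⁻¹ * R)) ^ 2 with hB
  have hrhs : a * ‖(A * ψ) • (a⁻¹ • z + w)‖ ^ 2 + b * ‖(A * ψ) • (w - b⁻¹ • z)‖ ^ 2 ≤ B := by
    rw [hB]; gcongr
  have hgG : -G ≤ (1 - ε ^ 2) * g := by
    have h3 : (1 - ε ^ 2) * (-G) ≤ (1 - ε ^ 2) * g :=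
      mul_le_mul_of_nonneg_left hg (by linarith)
    have h4 : 0 ≤ ε ^ 2 * G := by positivity
    linarith
  have hlower : A * H⁻¹ ≤ A * ψ * (A * ‖w‖ ^ 2 + 2 * ((1 - ε ^ 2) * g)) :=
    (mul_le_mul_of_nonneg_left hHψ hA.le).trans
      (le_mul_of_one_le_right (by positivity) (by linarith))
  have hlt := mul_lt_mul_of_pos_left (hsmall.trans_le hlower) hε
  have h3 : ε ^ 2 * (-K) ≤ ε ^ 2 * v := mul_le_mul_of_nonneg_left hv (sq_nonneg ε)
  have h4 := mul_le_mul_of_nonneg_left hrhs (sq_nonneg ε)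
  linarith

theorem neg_le_fderiv_div_of_combo {E : Type*} [NormedAddCommGroup E] [NormedSpace ℝ E]
    {Ω : Set E} (hΩ : IsOpen Ω) (hconv : Convex ℝ Ω) {φ : E → ℝ} (hpos : ∀ x ∈ Ω, 0 < φ x)
    {C κ S a b : ℝ} (hC : 0 ≤ C) (hκ : 0 < κ)
    (hκφ : ∀ x ∈ Ω, κ * infDist x (frontier Ω) ≤ φ x)
    (hgrad : ∀ x ∈ Ω, ∀ z ∈ Ω, -(C * (1 + ‖x - z‖) * infDist z (frontier Ω))
      ≤ fderivWithin ℝ φ (closure Ω) z (x - z))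
    (hS0 : 0 ≤ S) (hS : ∀ x ∈ Ω, ∀ y ∈ Ω, ‖x - y‖ ≤ S) (ha : 0 < a) (hb : 0 < b) (hab : a + b = 1)
    {x y : E} (hx : x ∈ Ω) (hy : y ∈ Ω) :
    -(C * (1 + S) / (b * κ)) ≤ fderiv ℝ φ (a • x + b • y) (x - y) / φ (a • x + b • y) := by
  set z := a • x + b • y with hz
  have hzΩ : z ∈ Ω := hconv hx hy ha.le hb.le hab
  have h := hgrad x hx z hzΩ
  rw [fderivWithin_of_mem_nhds (mem_of_superset (hΩ.mem_nhds hzΩ) subset_closure)] at h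
  have hxz : x - z = b • (x - y) := by
    have : x = (a + b) • x := by rw [hab, one_smul]
    rw [hz]; nth_rewrite 1 [this]; module
  have h3 := hS x hx z hzΩ
  rw [hxz, map_smul, smul_eq_mul, ← hxz] at h
  have h4 := hκφ z hzΩ
  have hd0 : 0 ≤ infDist z (frontier Ω) := infDist_nonneg
  have h5 : C * (1 + ‖x - z‖) * infDist z (frontier Ω) ≤ C * (1 + S) * infDist z (frontier Ω) := by
    gcongr
  set G := C * (1 + S) / (b * κ) with hG
  have hG0 : 0 ≤ G := by positivity
  have h6 : C * (1 + S) * infDist z (frontier Ω) ≤ b * (G * φ z) := by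
    calc C * (1 + S) * infDist z (frontier Ω)
        = b * (G * (κ * infDist z (frontier Ω))) := by rw [hG]; field_simp
      _ ≤ b * (G * φ z) := by gcongr
  rw [le_div_iff₀ (hpos z hzΩ)]
  have h7 : b * (-(G * φ z)) ≤ b * fderiv ℝ φ z (x - y) := by linarith
  have := le_of_mul_le_mul_left h7 hb
  linarith

/-- If the concavity defect of `log d + Q` at `x, y` is at least `m`, and `Q` oscillates by less
than `m` at scale `ω`, then `x` and `y` are at distance at least `ω`. -/
theorem le_norm_sub_of_le_combo {E : Type*} [NormedAddCommGroup E] [NormedSpace ℝ E]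
    {Ω : Set E} (hΩ : IsOpen Ω) (hconv : Convex ℝ Ω) (hfr : (frontier Ω).Nonempty)
    {ℓ Q : E → ℝ} (hQ : ∀ x ∈ Ω, ℓ x = Real.log (infDist x (frontier Ω)) + Q x) {m ω : ℝ}
    (hω : ∀ x ∈ Ω, ∀ y ∈ Ω, dist x y < ω → dist (Q x) (Q y) < m)
    {x y : E} (hx : x ∈ Ω) (hy : y ∈ Ω) {a b : ℝ} (ha : 0 < a) (hb : 0 < b) (hab : a + b = 1)
    (hZ : m ≤ a * ℓ x + b * ℓ y - ℓ (a • x + b • y)) : ω ≤ ‖x - y‖ := by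
  set z := a • x + b • y with hz
  have hzΩ : z ∈ Ω := hconv hx hy ha.le hb.le hab
  by_contra! hlt
  have hxz : x - z = b • (x - y) := by
    have : x = (a + b) • x := by rw [hab, one_smul]
    rw [hz]; nth_rewrite 1 [this]; module
  have hyz : y - z = -(a • (x - y)) := by
    have : y = (a + b) • y := by rw [hab, one_smul]
    rw [hz]; nth_rewrite 1 [this]; module
  have d1 : dist x z < ω := by
    rw [dist_eq_norm, hxz, norm_smul, Real.norm_of_nonneg hb.le]
    exact (mul_le_of_le_one_left (norm_nonneg _) (by linarith)).trans_lt hlt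
  have d2 : dist y z < ω := by
    rw [dist_eq_norm, hyz, norm_neg, norm_smul, Real.norm_of_nonneg ha.le]
    exact (mul_le_of_le_one_left (norm_nonneg _) (by linarith)).trans_lt hlt
  have q1 := hω x hx z hzΩ d1
  have q2 := hω y hy z hzΩ d2
  rw [Real.dist_eq, abs_lt] at q1 q2
  have q3 := combo_log_infDist_le hΩ hconv hfr hx hy ha hb hab
  rw [hQ x hx, hQ y hy, hQ z hzΩ] at hZ
  have q4 : a * (Q x - Q z) < a * m := mul_lt_mul_of_pos_left q1.2 ha
  have q5 : b * (Q y - Q z) < b * m := mul_lt_mul_of_pos_left q2.2 hb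
  have q6 : a * m + b * m = m := by rw [← add_mul, hab, one_mul]
  have q7 : a * Q z + b * Q z = Q z := by rw [← add_mul, hab, one_mul]
  linarith

/-- **Log-concavity of the ground state (Brascamp–Lieb).**  If `Ω ⊂ ℝⁿ` is a bounded
strictly convex open domain with smooth boundary and `V` is a smooth convex potential on
`Ω̄`, then the ground state `φ₀` of `-Δ + V` with Dirichlet boundary condition is
log-concave on `Ω`, i.e. `log φ₀` is concave on `Ω`. -/
theorem ground_state_log_concave
    {n : ℕ} {Ω : Set (EuclideanSpace ℝ (Fin n))}
    (hΩopen : IsOpen Ω) (hΩne : Ω.Nonempty) (hΩbdd : Bornology.IsBounded Ω)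
    (hΩconv : StrictConvex ℝ Ω)
    (hΩsmooth : ∃ r₀ > 0, ContDiffOn ℝ (⊤ : ℕ∞) (fun x => Metric.infDist x (frontier Ω))
      {x ∈ closure Ω | Metric.infDist x (frontier Ω) ≤ r₀})
    {V φ₀ : EuclideanSpace ℝ (Fin n) → ℝ} {lam₀ : ℝ}
    (hV : ContDiffOn ℝ (⊤ : ℕ∞) V (closure Ω)) (hVconv : ConvexOn ℝ (closure Ω) V)
    (hφ₀smooth : ContDiffOn ℝ (⊤ : ℕ∞) φ₀ (closure Ω))
    (hφ₀pos : ∀ x ∈ Ω, 0 < φ₀ x)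
    (hφ₀bd : ∀ x ∈ frontier Ω, φ₀ x = 0)
    (hφ₀eig : ∀ x ∈ Ω, -lap φ₀ x + V x * φ₀ x = lam₀ * φ₀ x) :
    ConcaveOn ℝ Ω (fun x => Real.log (φ₀ x)) := by
  have hconv : Convex ℝ Ω := hΩconv.convex
  refine concaveOn_iff_forall_pos.2 ⟨hconv, fun x₁ hx₁ y₁ hy₁ a b ha hb hab => ?_⟩
  simp only [smul_eq_mul]
  by_contra! hlt
  set z₁ := a • x₁ + b • y₁ with hz₁
  have hz₁Ω : z₁ ∈ Ω := hconv hx₁ hy₁ ha.le hb.le hab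
  set m := a * Real.log (φ₀ x₁) + b * Real.log (φ₀ y₁) - Real.log (φ₀ z₁) with hm
  have hm0 : 0 < m := by linarith
  have hfr : (frontier Ω).Nonempty := by
    have hne : x₁ ≠ y₁ := by
      rintro rfl
      rw [hz₁, ← add_smul, ← add_mul, hab, one_smul, one_mul] at hlt
      exact lt_irrefl _ hlt
    have : Nontrivial (EuclideanSpace ℝ (Fin n)) := ⟨⟨x₁, y₁, hne⟩⟩
    refine nonempty_frontier_iff.2 ⟨hΩne, ?_⟩
    rintro rfl
    exact NormedSpace.unbounded_univ ℝ (EuclideanSpace ℝ (Fin n)) hΩbdd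
  have hcomp : IsCompact (closure Ω) := hΩbdd.isCompact_closure
  have huniq : UniqueDiffOn ℝ (closure Ω) :=
    uniqueDiffOn_convex hconv.closure (hΩne.mono (interior_maximal subset_closure hΩopen))
  have h2 : (2 : WithTop ℕ∞) ≤ ((⊤ : ℕ∞) : WithTop ℕ∞) := ENat.LEInfty.out
  have hφ2 : ContDiffOn ℝ 2 φ₀ (closure Ω) := hφ₀smooth.of_le h2
  have hφΩ : ContDiffOn ℝ 2 φ₀ Ω := hφ2.mono subset_closure
  have hφd : DifferentiableOn ℝ φ₀ (closure Ω) := hφ2.differentiableOn (by norm_num)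
  have hφnn : ∀ x ∈ closure Ω, 0 ≤ φ₀ x := by
    intro x hx
    by_cases hxΩ : x ∈ Ω
    · exact (hφ₀pos x hxΩ).le
    · exact (hφ₀bd x (by rw [hΩopen.frontier_eq]; exact ⟨hx, hxΩ⟩)).ge
  obtain ⟨r₀, hr₀, hsm⟩ := hΩsmooth
  obtain ⟨κ, hκ, hκφ⟩ := exists_mul_infDist_frontier_le hΩopen hΩne hΩbdd hconv hfr hr₀
    (hsm.of_le h2) hV.continuousOn hφ2.continuousOn hφΩ hφ₀pos hφ₀bd hφ₀eig
  obtain ⟨C, hC0, hCb, hC⟩ := exists_lipschitz_fderivWithin hconv.closure hcomp huniq hφ2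
  obtain ⟨Q, hQc, hQ⟩ := exists_continuousOn_log_eq hΩopen hconv hfr hφd hφnn hφ₀bd hC0 hC hκ hκφ
  obtain ⟨q, hq⟩ := hcomp.exists_bound_of_continuousOn hQc
  obtain ⟨R, hR⟩ := hcomp.exists_bound_of_continuousOn continuousOn_id
  obtain ⟨M, hM⟩ := hcomp.exists_bound_of_continuousOn hφ2.continuousOn
  obtain ⟨K, hK⟩ := hcomp.exists_bound_of_continuousOn
    (hV.continuousOn.sub (continuousOn_const (c := lam₀)))
  obtain ⟨ω, hω, hωQ⟩ := Metric.uniformContinuousOn_iff.1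
    (hcomp.uniformContinuousOn_of_continuous hQc) (m / 2) (by linarith)
  replace hR : ∀ x ∈ Ω, ‖x‖ ≤ R := fun x hx => hR x (subset_closure hx)
  have hR0 : 0 ≤ R := (norm_nonneg _).trans (hR x₁ hx₁)
  have hK0 : 0 ≤ K := (norm_nonneg _).trans (hK x₁ (subset_closure hx₁))
  have hlogM : ∀ x ∈ Ω, Real.log (φ₀ x) ≤ Real.log M := fun x hx =>
    Real.log_le_log (hφ₀pos x hx) ((le_abs_self _).trans (hM x (subset_closure hx)))
  have hwR : ∀ x ∈ Ω, ∀ y ∈ Ω, ‖x - y‖ ≤ 2 * R := fun x hx y hy =>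
    (norm_sub_le _ _).trans (by linarith [hR x hx, hR y hy])
  set G := C * (1 + 2 * R) / (b * κ) with hG
  have hG0 : 0 ≤ G := by positivity
  have hgrad : ∀ x ∈ Ω, ∀ y ∈ Ω, -G ≤ fderiv ℝ φ₀ (a • x + b • y) (x - y) / φ₀ (a • x + b • y) := by
    intro x hx y hy
    exact neg_le_fderiv_div_of_combo hΩopen hconv hφ₀pos hC0 hκ hκφ
      (fun x hx z hz => neg_mul_infDist_le_fderivWithin hconv hfr hφd hφnn hφ₀bd hCb hC
        (subset_closure hx) (subset_closure hz)) (by positivity) hwR ha hb hab hx hy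
  set A := (1 + 2 * G) / ω ^ 2 with hA
  have hA0 : 0 < A := by positivity
  set H := Real.exp (A * (2 * R * R)) with hH
  have hH0 : 0 < H := Real.exp_pos _
  have hinner : ∀ x ∈ Ω, ∀ y ∈ Ω, |⟪x - y, a • x + b • y⟫| ≤ 2 * R * R := fun x hx y hy =>
    (abs_real_inner_le_norm _ _).trans (mul_le_mul (hwR x hx y hy)
      (hR _ (hconv hx hy ha.le hb.le hab)) (norm_nonneg _) (by linarith))
  have hψle : ∀ x ∈ Ω, ∀ y ∈ Ω, Real.exp (A * ⟪x - y, a • x + b • y⟫) ≤ H := fun x hx y hy =>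
    Real.exp_le_exp.2 (mul_le_mul_of_nonneg_left (abs_le.1 (hinner x hx y hy)).2 hA0.le)
  have hψge : ∀ x ∈ Ω, ∀ y ∈ Ω, H⁻¹ ≤ Real.exp (A * ⟪x - y, a • x + b • y⟫) := by
    intro x hx y hy
    rw [hH, ← Real.exp_neg, ← mul_neg]
    exact Real.exp_le_exp.2 (mul_le_mul_of_nonneg_left (abs_le.1 (hinner x hx y hy)).1 hA0.le)
  set B := a * (A * H * (a⁻¹ * R + 2 * R)) ^ 2 + b * (A * H * (2 * R + b⁻¹ * R)) ^ 2 with hB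
  have hB0 : 0 ≤ B := by positivity
  obtain ⟨ε, hε, hε1, hεm, hεc⟩ := exists_small_pos
    (P := H + (Real.log M - Real.log (φ₀ z₁))) (T := B + K) (m := m / 2) (c := A * H⁻¹)
    (by linarith [hlogM z₁ hz₁Ω]) (by positivity) (by linarith) (by positivity)
  have hε2 : ε ^ 2 ≤ ε := by nlinarith
  obtain ⟨x, hx, y, hy, hmax, hge⟩ := exists_isLocalMax_two_point hΩopen hΩbdd hconv hfr
    (ℓ := fun x => Real.log (φ₀ x))
    (hφΩ.continuousOn.log fun x hx => (hφ₀pos x hx).ne') hQ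
    (fun x hx => hq x (subset_closure hx))
    (W := fun p => ε * Real.exp (A * ⟪p.1 - p.2, a • p.1 + b • p.2⟫)) (by fun_prop)
    (H := ε * H) (fun x hx y hy => mul_le_mul_of_nonneg_left (hψle x hx y hy) hε.le)
    ha hb hab (δ := ε ^ 2) (by positivity) (by linarith) hx₁ hy₁ rfl
  set z := a • x + b • y with hz
  have hzΩ : z ∈ Ω := hconv hx hy ha.le hb.le hab
  have hψ1 := hψle x hx y hy
  have hψ2 := hψge x hx y hy
  set ψ := Real.exp (A * ⟪x - y, a • x + b • y⟫) with hψ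
  have hψ0 : 0 < ψ := Real.exp_pos _
  have hZ : m / 2 ≤ a * Real.log (φ₀ x) + b * Real.log (φ₀ y) - Real.log (φ₀ z) := by
    simp only [← hz₁] at hge
    have e1 : 0 < ε * Real.exp (A * ⟪x₁ - y₁, z₁⟫) := by positivity
    have e2 : ε * ψ ≤ ε * H := mul_le_mul_of_nonneg_left hψ1 hε.le
    have e3 : ε ^ 2 * (Real.log (φ₀ z) - Real.log (φ₀ z₁))
        ≤ ε * (Real.log M - Real.log (φ₀ z₁)) :=
      (mul_le_mul_of_nonneg_left (by linarith [hlogM z hzΩ]) (sq_nonneg ε)).trans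
        (mul_le_mul_of_nonneg_right hε2 (by linarith [hlogM z₁ hz₁Ω]))
    linarith
  have hwω : ω ≤ ‖x - y‖ :=
    le_norm_sub_of_le_combo hΩopen hconv hfr hQ
      (fun x hx y hy => hωQ x (subset_closure hx) y (subset_closure hy)) hx hy ha hb hab hZ
  have hVz : V z ≤ a * V x + b * V y :=
    hVconv.2 (subset_closure hx) (subset_closure hy) ha.le hb.le hab
  have hineq := two_point_max_ineq hΩopen hφΩ hφ₀pos hφ₀eig hx hy hzΩ ha hb hab hz rfl hVz
    (sq_nonneg ε) (by linarith) hψ hmax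
  have hAw : 1 + 2 * G ≤ A * ‖x - y‖ ^ 2 := by
    calc 1 + 2 * G = A * ω ^ 2 := by rw [hA]; field_simp
      _ ≤ A * ‖x - y‖ ^ 2 := by gcongr
  exact hineq.not_gt (lt_of_perturbation_small ha hb hA0 hψ0 hψ1 hψ2 (hwR x hx y hy)
    (hR z hzΩ) hAw hG0 (hgrad x hx y hy) (abs_le.1 (hK z (subset_closure hzΩ))).1 hε
    (by linarith) hεc)
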